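/- Let P ⊂ ℝⁿ be a bounded open convex polytope containing the origin, presented as P = {x : ⟨l_i, x⟩ < λ_i, i = 1,…,d}, satisfying the Delzant condition, and let f be an affine function on ℝⁿ. Suppose ℱ is proper on 𝒞̃: there is a continuous function p : ℝ → ℝ with p(t) → +∞ as t → +∞ such that ℱ(u) ≥ p(∫_P u dx) for all u ∈ 𝒞̃. Then there exists K₀ > 0 such that every u ∈ 𝒞̃ with ℱ(u) ≤ inf_{𝒞̃} ℱ + 1 satisfies ∫_{∂P} u dσ < K₀. -/

import Mathlib

open MeasureTheory Filter Set Metric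
open scoped ENNReal RealInnerProductSpace Topology NNReal

noncomputable section

namespace ToricExtremal

/-- The open polytope `{x | ⟨l i, x⟩ < λ i for all i}` determined by a half-space
presentation with normals `l` and constants `lam`. -/
def Poly {n : ℕ} {ι : Type*} [Fintype ι] (l : ι → EuclideanSpace ℝ (Fin n))
    (lam : ι → ℝ) : Set (EuclideanSpace ℝ (Fin n)) :=
  {x | ∀ i, ⟪l i, x⟫ < lam i}

/-- The inner polytope `P_δ`, whose facets are parallel to those of `P` at distance `δ`. -/
def PolyInner {n : ℕ} {ι : Type*} [Fintype ι] (l : ι → EuclideanSpace ℝ (Fin n))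
    (lam : ι → ℝ) (δ : ℝ) : Set (EuclideanSpace ℝ (Fin n)) :=
  {x | ∀ i, ⟪l i, x⟫ < lam i - ‖l i‖ * δ}

/-- The facet `F i = {x ∈ ∂P | ⟨l i, x⟩ = λ i}`. -/
def Facet {n : ℕ} {ι : Type*} [Fintype ι] (l : ι → EuclideanSpace ℝ (Fin n))
    (lam : ι → ℝ) (i : ι) : Set (EuclideanSpace ℝ (Fin n)) :=
  {x ∈ frontier (Poly l lam) | ⟪l i, x⟫ = lam i}

/-- `σ₀`: the `(n-1)`-dimensional Hausdorff measure on `ℝⁿ`. -/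
def sigma0 (n : ℕ) : Measure (EuclideanSpace ℝ (Fin n)) := μH[(n : ℝ) - 1]

/-- The weighted boundary measure `σ`, equal to `|l i|⁻¹ σ₀` on the facet `F i`. -/
def sigmaW {n : ℕ} {ι : Type*} [Fintype ι] (l : ι → EuclideanSpace ℝ (Fin n))
    (lam : ι → ℝ) : Measure (EuclideanSpace ℝ (Fin n)) :=
  ∑ i : ι, (ENNReal.ofReal (1 / ‖l i‖)) • ((sigma0 n).restrict (Facet l lam i))

/-- The Delzant condition: every normal `l i` is a primitive integral vector, and every
vertex (extreme point of the closure) lies on exactly `n` facets whose normals form a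
`ℤ`-basis of `ℤⁿ` (equivalently, an integral matrix of determinant `±1`). -/
def IsDelzant {n : ℕ} {ι : Type*} [Fintype ι] (l : ι → EuclideanSpace ℝ (Fin n))
    (lam : ι → ℝ) : Prop :=
  (∀ i j, ∃ m : ℤ, l i j = (m : ℝ)) ∧
  (∀ i, ∀ k : ℕ, 2 ≤ k → ¬ (∀ j, ∃ m : ℤ, l i j = (k : ℝ) * (m : ℝ))) ∧
  (∀ x ∈ Set.extremePoints ℝ (closure (Poly l lam)),
    ∃ e : Fin n ≃ {i : ι // ⟪l i, x⟫ = lam i},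
      |(Matrix.of fun j k => l (e j).1 k).det| = 1)

/-- The second partial derivative `∂²u/∂xᵢ∂xⱼ` at `x`. -/
def secondPartial {n : ℕ} (u : EuclideanSpace ℝ (Fin n) → ℝ) (i j : Fin n)
    (x : EuclideanSpace ℝ (Fin n)) : ℝ :=
  iteratedFDeriv ℝ 2 u x ![EuclideanSpace.single i 1, EuclideanSpace.single j 1]

/-- The (classical) Hessian matrix `D²u(x)`. -/
def hessianMatrix {n : ℕ} (u : EuclideanSpace ℝ (Fin n) → ℝ)
    (x : EuclideanSpace ℝ (Fin n)) : Matrix (Fin n) (Fin n) ℝ :=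
  Matrix.of fun i j => secondPartial u i j x

/-- Guillemin's canonical potential `u_P(x) = Σᵢ (λᵢ − ⟨lᵢ,x⟩) log (λᵢ − ⟨lᵢ,x⟩)`. -/
def guillemin {n : ℕ} {ι : Type*} [Fintype ι] (l : ι → EuclideanSpace ℝ (Fin n))
    (lam : ι → ℝ) (x : EuclideanSpace ℝ (Fin n)) : ℝ :=
  ∑ i : ι, (lam i - ⟪l i, x⟫) * Real.log (lam i - ⟪l i, x⟫)

/-- `(u_P)^{ij}_{ij}`: the double divergence `Σ_{i,j} ∂²((D²u_P)⁻¹)_{ij}/∂xᵢ∂xⱼ` of the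
inverse Hessian of the Guillemin potential. -/
def divDivInvHessGuillemin {n : ℕ} {ι : Type*} [Fintype ι]
    (l : ι → EuclideanSpace ℝ (Fin n)) (lam : ι → ℝ) (x : EuclideanSpace ℝ (Fin n)) : ℝ :=
  ∑ i : Fin n, ∑ j : Fin n,
    secondPartial (fun y => (hessianMatrix (guillemin l lam) y)⁻¹ i j) i j x

/-- `H` is an Alexandrov Hessian of `u` on `P`: a measurable matrix-valued map which is
a.e. positive semidefinite and gives the second-order Taylor expansion of `u` at a.e.
point of `P`. -/
def IsAlexHessian {n : ℕ} (P : Set (EuclideanSpace ℝ (Fin n)))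
    (u : EuclideanSpace ℝ (Fin n) → ℝ)
    (H : EuclideanSpace ℝ (Fin n) → Matrix (Fin n) (Fin n) ℝ) : Prop :=
  (∀ i j, Measurable fun x => H x i j) ∧
  ∀ᵐ x ∂(volume.restrict P),
    (H x).PosSemidef ∧
    ∃ g : EuclideanSpace ℝ (Fin n),
      Tendsto (fun y : EuclideanSpace ℝ (Fin n) =>
          (u y - u x - ⟪g, y - x⟫
            - (1 / 2) * ∑ i : Fin n, ∑ j : Fin n, H x i j * (y - x) i * (y - x) j)
          / ‖y - x‖ ^ 2)
        (𝓝[≠] x) (𝓝 0)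

/-- The radial boundary extension `u(z) = lim_{t→1⁻} u (t • z)` (as a value in `[0,∞]`,
computed via `limsup` so as to be everywhere defined). -/
def radExt {n : ℕ} (u : EuclideanSpace ℝ (Fin n) → ℝ) (z : EuclideanSpace ℝ (Fin n)) : ℝ≥0∞ :=
  Filter.limsup (fun t : ℝ => ENNReal.ofReal (u (t • z))) (𝓝[<] (1 : ℝ))

/-- The radial limits of `u` exist (in `[0,∞]`) at every boundary point of `P`. -/
def HasRadExt {n : ℕ} (P : Set (EuclideanSpace ℝ (Fin n)))
    (u : EuclideanSpace ℝ (Fin n) → ℝ) : Prop :=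
  ∀ z ∈ frontier P,
    Tendsto (fun t : ℝ => ENNReal.ofReal (u (t • z))) (𝓝[<] (1 : ℝ)) (𝓝 (radExt u z))

/-- The class `𝒞⋆^K(P)`: nonnegative convex functions on `P`, vanishing at the origin,
whose radial boundary extension has `σ₀`-integral at most `K`. -/
def MemCstar {n : ℕ} {ι : Type*} [Fintype ι] (l : ι → EuclideanSpace ℝ (Fin n))
    (lam : ι → ℝ) (K : ℝ) (u : EuclideanSpace ℝ (Fin n) → ℝ) : Prop :=
  ConvexOn ℝ (Poly l lam) u ∧ u 0 = 0 ∧ (∀ x ∈ Poly l lam, 0 ≤ u x) ∧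
  HasRadExt (Poly l lam) u ∧
  ∫⁻ z in frontier (Poly l lam), radExt u z ∂(sigma0 n) ≤ ENNReal.ofReal K

/-- The class `𝒞`: convex functions of the form `u = u_P + v` with `v` smooth up to the
boundary of `P`. -/
def MemC {n : ℕ} {ι : Type*} [Fintype ι] (l : ι → EuclideanSpace ℝ (Fin n))
    (lam : ι → ℝ) (u : EuclideanSpace ℝ (Fin n) → ℝ) : Prop :=
  ConvexOn ℝ (Poly l lam) u ∧
  ∃ v : EuclideanSpace ℝ (Fin n) → ℝ, ContDiffOn ℝ (⊤ : ℕ∞) v (closure (Poly l lam)) ∧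
    ∀ x ∈ closure (Poly l lam), u x = guillemin l lam x + v x

/-- The normalized class `𝒞̃ = {u ∈ 𝒞 : inf_P u = u 0 = 0}`. -/
def MemCt {n : ℕ} {ι : Type*} [Fintype ι] (l : ι → EuclideanSpace ℝ (Fin n))
    (lam : ι → ℝ) (u : EuclideanSpace ℝ (Fin n) → ℝ) : Prop :=
  MemC l lam u ∧ u 0 = 0 ∧ ∀ x ∈ Poly l lam, 0 ≤ u x

/-- `f` is an affine function on `ℝⁿ`. -/
def IsAffineFn {n : ℕ} (f : EuclideanSpace ℝ (Fin n) → ℝ) : Prop :=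
  ∃ (g : EuclideanSpace ℝ (Fin n)) (c : ℝ), ∀ x, f x = ⟪g, x⟫ + c

/-- The (signed) integral `∫_S log (det H) dx`, with values in `EReal`: it is defined as
the difference of the integrals of the positive part `log⁺` and the negative part `log⁻`. -/
def logDetE {n : ℕ} (S : Set (EuclideanSpace ℝ (Fin n)))
    (H : EuclideanSpace ℝ (Fin n) → Matrix (Fin n) (Fin n) ℝ) : EReal :=
  ((∫⁻ x in S, ENNReal.ofReal (Real.log (H x).det) : ℝ≥0∞) : EReal)
    - ((∫⁻ x in S, ENNReal.ofReal (-Real.log (H x).det) : ℝ≥0∞) : EReal)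

/-- The Donaldson functional
`ℱ(u) = −∫_P log (det H) dx + ∫_{∂P} u dσ − ∫_P f ⬝ u dx`, valued in `EReal`, where `H` is
an Alexandrov Hessian of `u` and the boundary term uses the radial extension of `u`. -/
def Fcal {n : ℕ} {ι : Type*} [Fintype ι] (l : ι → EuclideanSpace ℝ (Fin n)) (lam : ι → ℝ)
    (f : EuclideanSpace ℝ (Fin n) → ℝ) (u : EuclideanSpace ℝ (Fin n) → ℝ)
    (H : EuclideanSpace ℝ (Fin n) → Matrix (Fin n) (Fin n) ℝ) : EReal :=
  ((∫⁻ z, radExt u z ∂(sigmaW l lam) : ℝ≥0∞) : EReal)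
    - ((∫ x in Poly l lam, f x * u x : ℝ) : EReal)
    - logDetE (Poly l lam) H

/-- The half-space presentation of the open rectangle `∏ (αᵢ, βᵢ)`: normals. -/
def rectL (n : ℕ) : (Fin n ⊕ Fin n) → EuclideanSpace ℝ (Fin n) :=
  Sum.elim (fun i => EuclideanSpace.single i 1) (fun i => -EuclideanSpace.single i 1)

/-- The half-space presentation of the open rectangle `∏ (αᵢ, βᵢ)`: constants. -/
def rectLam {n : ℕ} (α β : Fin n → ℝ) : (Fin n ⊕ Fin n) → ℝ :=
  Sum.elim β (fun i => -α i)


/-- The functional `ℱ` on smooth elements of `𝒞̃` (real-valued):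
`ℱ(u) = −∫_P log det D²u + ∫_{∂P} u dσ − ∫_P f ⬝ u dx`. -/
def FcalSmooth {n : ℕ} {ι : Type*} [Fintype ι] (l : ι → EuclideanSpace ℝ (Fin n))
    (lam : ι → ℝ) (f u : EuclideanSpace ℝ (Fin n) → ℝ) : ℝ :=
  -(∫ x in Poly l lam, Real.log ((hessianMatrix u x).det))
    + ((∫ z, u z ∂(sigmaW l lam)) - ∫ x in Poly l lam, f x * u x)

/-! ### Second-order symmetric differences and Hessians -/

section SecondDifference

variable {E : Type*} [NormedAddCommGroup E] [NormedSpace ℝ E]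

theorem tendsto_symmetric_second_difference {u : E → ℝ} {x : E} (hu : ContDiffAt ℝ 2 u x)
    (e : E) :
    Tendsto (fun t : ℝ => (u (x + t • e) + u (x - t • e) - 2 * u x) / t ^ 2) (𝓝[≠] 0)
      (𝓝 (iteratedFDeriv ℝ 2 u x ![e, e])) := by
  have hplus : Tendsto (fun t : ℝ => x + t • e) (𝓝 0) (𝓝 x) := by
    have : Continuous fun t : ℝ => x + t • e := by fun_prop
    simpa using this.tendsto 0
  have hminus : Tendsto (fun t : ℝ => x - t • e) (𝓝 0) (𝓝 x) := by
    have : Continuous fun t : ℝ => x - t • e := by fun_prop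
    simpa using this.tendsto 0
  have hdiff : ∀ᶠ y in 𝓝 x, DifferentiableAt ℝ u y := by
    filter_upwards [hu.eventually (by simp)] with y hy
    exact hy.differentiableAt (by norm_num)
  have hcurve : ∀ (s : ℝ) (t : ℝ), HasDerivAt (fun t : ℝ => x + (s * t) • e) (s • e) t := by
    intro s t
    simpa using (((hasDerivAt_id t).const_mul s).smul_const e).const_add x
  have hf' : HasFDerivAt (fderiv ℝ u) (fderiv ℝ (fderiv ℝ u) x) x :=
    ((hu.fderiv_right (m := 1) (by norm_num)).differentiableAt (by norm_num)).hasFDerivAt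
  set b : ℝ := iteratedFDeriv ℝ 2 u x ![e, e] with hb
  have hb' : b = fderiv ℝ (fderiv ℝ u) x e e := by
    rw [hb, iteratedFDeriv_two_apply]; rfl
  have hslope : ∀ s : ℝ,
      HasDerivAt (fun t : ℝ => fderiv ℝ u (x + (s * t) • e) e) (s * b) 0 := by
    intro s
    have h0 : HasFDerivAt (fderiv ℝ u) (fderiv ℝ (fderiv ℝ u) x) (x + (s * 0) • e) := by
      simpa using hf'
    have h1 := h0.comp_hasDerivAt (0 : ℝ) (hcurve s 0)
    have h2 := (ContinuousLinearMap.apply ℝ ℝ e).hasFDerivAt.comp_hasDerivAt (0 : ℝ) h1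
    rw [map_smul, ContinuousLinearMap.apply_apply, _root_.smul_apply, ← hb', smul_eq_mul] at h2
    exact h2
  have hm := ((hslope 1).sub (hslope (-1))).tendsto_slope_zero
  refine HasDerivAt.lhopital_zero_nhdsNE
    (f' := fun t => fderiv ℝ u (x + t • e) e - fderiv ℝ u (x - t • e) e)
    (g' := fun t => 2 * t) ?_ ?_ ?_ ?_ ?_ ?_
  · refine Filter.Eventually.filter_mono nhdsWithin_le_nhds ?_
    filter_upwards [hplus.eventually hdiff, hminus.eventually hdiff] with t h1 h2
    have k1 := h1.hasFDerivAt.comp_hasDerivAt t (f := fun t : ℝ => x + t • e)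
      (by simpa using hcurve 1 t)
    have k2 := h2.hasFDerivAt.comp_hasDerivAt t (f := fun t : ℝ => x - t • e)
      (by simpa [sub_eq_add_neg] using hcurve (-1) t)
    have := (k1.add k2).sub_const (2 * u x)
    simpa [sub_eq_add_neg, Function.comp_def] using this
  · exact Filter.Eventually.of_forall fun t => by simpa using hasDerivAt_pow 2 t
  · filter_upwards [self_mem_nhdsWithin] with t ht
    simpa using ht
  · refine Tendsto.mono_left ?_ nhdsWithin_le_nhds
    have hc := hu.continuousAt.tendsto
    have := ((hc.comp hplus).add (hc.comp hminus)).sub_const (2 * u x)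
    simpa [two_mul] using this
  · refine Tendsto.mono_left ?_ nhdsWithin_le_nhds
    simpa using (continuous_pow 2 (M := ℝ)).tendsto 0
  · have := hm.div_const 2
    have hlim : (1 * b - -1 * b) / 2 = b := by ring
    rw [hlim] at this
    refine this.congr' ?_
    filter_upwards [self_mem_nhdsWithin] with t ht
    have ht' : t ≠ 0 := ht
    simp only [Pi.sub_apply, zero_add, one_mul, neg_mul, neg_smul, zero_smul,
      add_zero, sub_self, sub_zero, smul_eq_mul, ← sub_eq_add_neg]
    field_simp

theorem symmetric_second_difference_nonneg {s : Set E} {u : E → ℝ} (hu : ConvexOn ℝ s u)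
    {x y : E} (hp : x + y ∈ s) (hm : x - y ∈ s) : 0 ≤ u (x + y) + u (x - y) - 2 * u x := by
  have h2 : (0 : ℝ) ≤ 1 / 2 := by norm_num
  have h := hu.2 hp hm h2 h2 (by norm_num)
  have hx : (1 / 2 : ℝ) • (x + y) + (1 / 2 : ℝ) • (x - y) = x := by module
  rw [hx] at h
  simp only [smul_eq_mul] at h
  linarith

theorem iteratedFDeriv_two_nonneg_of_convexOn {s : Set E} (hs : IsOpen s) {u : E → ℝ}
    (hconv : ConvexOn ℝ s u) {x : E} (hx : x ∈ s) (hu : ContDiffAt ℝ 2 u x) (e : E) :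
    0 ≤ iteratedFDeriv ℝ 2 u x ![e, e] := by
  refine ge_of_tendsto (tendsto_symmetric_second_difference hu e) ?_
  have hp : ∀ᶠ t : ℝ in 𝓝 0, x + t • e ∈ s := by
    have : Continuous fun t : ℝ => x + t • e := by fun_prop
    exact this.continuousAt.eventually (hs.mem_nhds (by simpa using hx))
  have hm : ∀ᶠ t : ℝ in 𝓝 0, x - t • e ∈ s := by
    have : Continuous fun t : ℝ => x - t • e := by fun_prop
    exact this.continuousAt.eventually (hs.mem_nhds (by simpa using hx))
  filter_upwards [nhdsWithin_le_nhds hp, nhdsWithin_le_nhds hm] with t h1 h2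
  exact div_nonneg (symmetric_second_difference_nonneg hconv h1 h2) (sq_nonneg t)

end SecondDifference

theorem hessianMatrix_posSemidef {n : ℕ} {s : Set (EuclideanSpace ℝ (Fin n))} (hs : IsOpen s)
    {u : EuclideanSpace ℝ (Fin n) → ℝ} (hconv : ConvexOn ℝ s u)
    {x : EuclideanSpace ℝ (Fin n)} (hx : x ∈ s) (hu : ContDiffAt ℝ 2 u x) :
    (hessianMatrix u x).PosSemidef := by
  refine Matrix.PosSemidef.of_dotProduct_mulVec_nonneg ?_ ?_
  · ext i j
    have h := hu.isSymmSndFDerivAt (by simp)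
    simpa [hessianMatrix, secondPartial, iteratedFDeriv_two_apply] using h.eq _ _
  · intro w
    have h := iteratedFDeriv_two_nonneg_of_convexOn hs hconv hx hu
      (∑ i, w i • EuclideanSpace.single i (1 : ℝ))
    refine h.trans_eq ?_
    simp only [iteratedFDeriv_two_apply, Matrix.cons_val_zero, Matrix.cons_val_one, map_sum,
      map_smul, _root_.sum_apply, _root_.smul_apply, smul_eq_mul,
      dotProduct, Matrix.mulVec, hessianMatrix, secondPartial, Matrix.of_apply, Pi.star_apply,
      star_trivial, Finset.mul_sum]
    rw [Finset.sum_comm]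
    refine Finset.sum_congr rfl fun i _ => Finset.sum_congr rfl fun j _ => ?_
    ring

theorem log_det_le_of_posSemidef {n : ℕ} {H : Matrix (Fin n) (Fin n) ℝ} (hH : H.PosSemidef) :
    Real.log H.det ≤ n * Real.log (1 + H.trace) := by
  have hev := hH.eigenvalues_nonneg
  have htr : H.trace = ∑ i, hH.1.eigenvalues i := by
    simpa using hH.1.trace_eq_sum_eigenvalues
  have htr0 : 0 ≤ H.trace := htr ▸ Finset.sum_nonneg fun i _ => hev i
  have hdet : H.det ≤ (1 + H.trace) ^ n := by
    have : H.det = ∏ i, hH.1.eigenvalues i := by simpa using hH.1.det_eq_prod_eigenvalues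
    rw [this]
    refine (Finset.prod_le_prod (fun i _ => hev i) (g := fun _ => 1 + H.trace)
      fun i _ => ?_).trans_eq (by simp)
    have := Finset.single_le_sum (fun j _ => hev j) (Finset.mem_univ i)
    linarith
  rcases hH.det_nonneg.eq_or_lt with h0 | hpos
  · rw [← h0, Real.log_zero]
    exact mul_nonneg n.cast_nonneg (Real.log_nonneg (by linarith))
  · rw [← Real.log_pow]
    exact Real.log_le_log hpos hdet

/-- The elementary inequality `log y ≤ y` in weighted form. -/
theorem log_one_add_le {r T : ℝ} (hr : 0 < r) (hT : 0 ≤ T) :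
    Real.log (1 + T) ≤ r ^ 2 + r ^ 2 * T - 2 * Real.log r := by
  have h : Real.log (r ^ 2 * (1 + T)) = 2 * Real.log r + Real.log (1 + T) := by
    rw [Real.log_mul (by positivity) (by positivity), Real.log_pow]; norm_num
  have := Real.log_le_sub_one_of_pos (x := r ^ 2 * (1 + T)) (by positivity)
  linarith

/-! ### The slack function of a polytope -/

section Slack

variable {n : ℕ} {ι : Type*} {l : ι → EuclideanSpace ℝ (Fin n)}
  {lam : ι → ℝ}

/-- The smallest slack `minᵢ (λᵢ − ⟨lᵢ, x⟩)` in the inequalities defining the polytope. -/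
def minSlack {n : ℕ} {ι : Type*} (l : ι → EuclideanSpace ℝ (Fin n)) (lam : ι → ℝ)
    (x : EuclideanSpace ℝ (Fin n)) : ℝ :=
  ⨅ i, (lam i - ⟪l i, x⟫)

/-- The cut-off `((ρ − ε)⁺)²`, with `ρ` the smallest slack. -/
def cutoff {n : ℕ} {ι : Type*} (l : ι → EuclideanSpace ℝ (Fin n)) (lam : ι → ℝ) (ε : ℝ)
    (x : EuclideanSpace ℝ (Fin n)) : ℝ :=
  max (minSlack l lam x - ε) 0 ^ 2

theorem cutoff_nonneg (ε : ℝ) (x : EuclideanSpace ℝ (Fin n)) : 0 ≤ cutoff l lam ε x :=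
  sq_nonneg _

theorem sq_max_zero_le (s t : ℝ) :
    max t 0 ^ 2 ≤ max s 0 ^ 2 + 2 * max s 0 * (t - s) + (t - s) ^ 2 := by
  rcases le_total s 0 with hs | hs <;> rcases le_total t 0 with ht | ht <;>
    simp only [max_eq_left, max_eq_right, hs, ht] <;> nlinarith

variable [Fintype ι]

theorem minSlack_le (i : ι) (x : EuclideanSpace ℝ (Fin n)) :
    minSlack l lam x ≤ lam i - ⟪l i, x⟫ :=
  ciInf_le (Set.finite_range _).bddBelow i

theorem measurable_minSlack (l : ι → EuclideanSpace ℝ (Fin n)) (lam : ι → ℝ) :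
    Measurable (minSlack l lam) :=
  Measurable.iInf fun i => by fun_prop

theorem measurable_cutoff (ε : ℝ) : Measurable (cutoff l lam ε) :=
  (((measurable_minSlack l lam).sub_const ε).max measurable_const).pow_const 2

theorem isOpen_Poly (l : ι → EuclideanSpace ℝ (Fin n)) (lam : ι → ℝ) : IsOpen (Poly l lam) := by
  have : Poly l lam = ⋂ i, {x | ⟪l i, x⟫ < lam i} := by ext; simp [Poly]
  rw [this]
  exact isOpen_iInter_of_finite fun i => isOpen_lt (by fun_prop) continuous_const

variable [Nonempty ι]

theorem exists_eq_minSlack (l : ι → EuclideanSpace ℝ (Fin n)) (lam : ι → ℝ)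
    (x : EuclideanSpace ℝ (Fin n)) : ∃ i, minSlack l lam x = lam i - ⟪l i, x⟫ := by
  obtain ⟨i, hi⟩ := exists_eq_ciInf_of_finite (f := fun i => lam i - ⟪l i, x⟫)
  exact ⟨i, hi.symm⟩

theorem minSlack_pos_iff {x : EuclideanSpace ℝ (Fin n)} :
    0 < minSlack l lam x ↔ x ∈ Poly l lam := by
  constructor
  · intro h i
    have := minSlack_le (l := l) (lam := lam) i x
    linarith
  · intro h
    obtain ⟨i, hi⟩ := exists_eq_minSlack l lam x
    have := h i
    linarith

theorem minSlack_add_le (x y : EuclideanSpace ℝ (Fin n)) :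
    minSlack l lam (x + y) ≤ minSlack l lam x + (∑ i, ‖l i‖) * ‖y‖ := by
  obtain ⟨i, hi⟩ := exists_eq_minSlack l lam x
  have h1 := minSlack_le (l := l) (lam := lam) i (x + y)
  rw [inner_add_right] at h1
  have h2 := (abs_le.1 (abs_real_inner_le_norm (l i) y)).1
  have h3 : ‖l i‖ * ‖y‖ ≤ (∑ i, ‖l i‖) * ‖y‖ := by
    gcongr
    exact Finset.single_le_sum (f := fun i => ‖l i‖) (fun j _ => norm_nonneg _) (Finset.mem_univ i)
  linarith

theorem minSlack_add_minSlack_sub_le (x y : EuclideanSpace ℝ (Fin n)) :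
    minSlack l lam (x + y) + minSlack l lam (x - y) ≤ 2 * minSlack l lam x := by
  obtain ⟨i, hi⟩ := exists_eq_minSlack l lam x
  have h1 := minSlack_le (l := l) (lam := lam) i (x + y)
  have h2 := minSlack_le (l := l) (lam := lam) i (x - y)
  rw [inner_add_right] at h1
  rw [inner_sub_right] at h2
  linarith

theorem cutoff_second_difference_le (ε : ℝ) (x y : EuclideanSpace ℝ (Fin n)) :
    cutoff l lam ε (x + y) + cutoff l lam ε (x - y) - 2 * cutoff l lam ε x
      ≤ 2 * (∑ i, ‖l i‖) ^ 2 * ‖y‖ ^ 2 := by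
  set L := ∑ i, ‖l i‖
  have a1 := minSlack_add_le (l := l) (lam := lam) x y
  have a2 := minSlack_add_le (l := l) (lam := lam) x (-y)
  have a3 := minSlack_add_le (l := l) (lam := lam) (x + y) (-y)
  have a4 := minSlack_add_le (l := l) (lam := lam) (x - y) y
  rw [add_neg_cancel_right, norm_neg] at a3
  rw [← sub_eq_add_neg, norm_neg] at a2
  rw [sub_add_cancel] at a4
  have hc := minSlack_add_minSlack_sub_le (l := l) (lam := lam) x y
  have b1 := sq_max_zero_le (minSlack l lam x - ε) (minSlack l lam (x + y) - ε)
  have b2 := sq_max_zero_le (minSlack l lam x - ε) (minSlack l lam (x - y) - ε)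
  have c1 : (minSlack l lam (x + y) - minSlack l lam x) ^ 2 ≤ (L * ‖y‖) ^ 2 :=
    sq_le_sq' (by linarith) (by linarith)
  have c2 : (minSlack l lam (x - y) - minSlack l lam x) ^ 2 ≤ (L * ‖y‖) ^ 2 :=
    sq_le_sq' (by linarith) (by linarith)
  have c3 : 0 ≤ max (minSlack l lam x - ε) 0 *
      (2 * minSlack l lam x - minSlack l lam (x + y) - minSlack l lam (x - y)) :=
    mul_nonneg (le_max_right _ _) (by linarith)
  unfold cutoff
  nlinarith

/-! ### Integrability of the logarithm of the slack -/

theorem setLIntegral_Icc_ofReal_neg_log_lt_top :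
    ∫⁻ y in Set.Icc (-1 : ℝ) 1, ENNReal.ofReal (-Real.log y) < ⊤ := by
  have h : IntegrableOn (fun y => -Real.log y) (Set.Icc (-1) 1) := by
    rw [integrableOn_Icc_iff_integrableOn_Ioc]
    exact ((intervalIntegrable_iff_integrableOn_Ioc_of_le (by norm_num)).1
      intervalIntegral.intervalIntegrable_log').neg
  exact h.lintegral_lt_top

theorem lintegral_ofReal_neg_log_lt_top : ∫⁻ y : ℝ, ENNReal.ofReal (-Real.log y) < ⊤ := by
  rw [← setLIntegral_eq_of_support_subset (s := Set.Icc (-1) 1)]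
  · exact setLIntegral_Icc_ofReal_neg_log_lt_top
  · intro y hy
    rw [Function.mem_support, ne_eq, ENNReal.ofReal_eq_zero, not_le, neg_pos] at hy
    rw [Set.mem_Icc, ← abs_le]
    by_contra! hlt
    rw [← Real.log_abs] at hy
    exact absurd (Real.log_pos hlt) (by linarith)

theorem setLIntegral_ofReal_neg_log_affine_lt_top {s : Set (EuclideanSpace ℝ (Fin n))}
    (hs : Bornology.IsBounded s) {a : EuclideanSpace ℝ (Fin n)} (ha : a ≠ 0) (c : ℝ) :
    ∫⁻ x in s, ENNReal.ofReal (-Real.log (c - ⟪a, x⟫)) < ⊤ := by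
  obtain ⟨R, hR⟩ := hs.subset_closedBall 0
  set G : ℝ → ℝ≥0∞ := fun y => ENNReal.ofReal (-Real.log y) with hG
  have hGm : Measurable G := by fun_prop
  set e : EuclideanSpace ℝ (Fin n) := (‖a‖ ^ 2)⁻¹ • a with he
  have hae : ⟪a, e⟫ = 1 := by
    rw [he, inner_smul_right, real_inner_self_eq_norm_sq, inv_mul_cancel₀]
    exact pow_ne_zero 2 (norm_ne_zero_iff.2 ha)
  set B := closedBall (0 : EuclideanSpace ℝ (Fin n)) R
  set B' := closedBall (0 : EuclideanSpace ℝ (Fin n)) (R + ‖e‖)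
  have hB' : MeasurableSet B' := measurableSet_closedBall
  have hshift : ∀ t ∈ Set.Icc (0 : ℝ) 1,
      ∫⁻ x in B, G (c - ⟪a, x⟫) ≤ ∫⁻ x in B', G (c - ⟪a, x⟫ - t) := by
    intro t ht
    rw [← lintegral_indicator measurableSet_closedBall, ← lintegral_indicator hB',
      ← lintegral_add_right_eq_self _ (t • e)]
    refine lintegral_mono fun x => ?_
    by_cases hx : x + t • e ∈ B
    · have hx' : x ∈ B' := by
        rw [mem_closedBall_zero_iff] at hx ⊢
        have h1 : ‖x‖ ≤ ‖x + t • e‖ + ‖t • e‖ := by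
          simpa using norm_sub_le (x + t • e) (t • e)
        have h2 : ‖t • e‖ ≤ ‖e‖ := by
          rw [norm_smul, Real.norm_of_nonneg ht.1]
          exact mul_le_of_le_one_left (norm_nonneg _) ht.2
        linarith
      rw [Set.indicator_of_mem hx, Set.indicator_of_mem hx', inner_add_right, inner_smul_right,
        hae, mul_one, sub_sub]
    · rw [Set.indicator_of_notMem hx]
      exact zero_le
  calc ∫⁻ x in s, G (c - ⟪a, x⟫) ≤ ∫⁻ x in B, G (c - ⟪a, x⟫) := lintegral_mono_set hR
    _ = ∫⁻ _ in Set.Icc (0 : ℝ) 1, ∫⁻ x in B, G (c - ⟪a, x⟫) := by simp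
    _ ≤ ∫⁻ t in Set.Icc (0 : ℝ) 1, ∫⁻ x in B', G (c - ⟪a, x⟫ - t) :=
        setLIntegral_mono' measurableSet_Icc hshift
    _ = ∫⁻ x in B', ∫⁻ t in Set.Icc (0 : ℝ) 1, G (c - ⟪a, x⟫ - t) := by
        refine lintegral_lintegral_swap (Measurable.aemeasurable ?_)
        refine hGm.comp ?_
        fun_prop
    _ ≤ ∫⁻ _ in B', ∫⁻ y, G y := by
        refine lintegral_mono fun x => ?_
        exact (setLIntegral_le_lintegral _ _).trans_eq (lintegral_sub_left_eq_self G _)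
    _ < ⊤ := by
        rw [setLIntegral_const]
        exact ENNReal.mul_lt_top lintegral_ofReal_neg_log_lt_top measure_closedBall_lt_top

theorem setLIntegral_ofReal_neg_log_minSlack_lt_top (hl : ∀ i, l i ≠ 0)
    {s : Set (EuclideanSpace ℝ (Fin n))} (hs : Bornology.IsBounded s) :
    ∫⁻ x in s, ENNReal.ofReal (-Real.log (minSlack l lam x)) < ⊤ := by
  calc ∫⁻ x in s, ENNReal.ofReal (-Real.log (minSlack l lam x))
      ≤ ∫⁻ x in s, ∑ i, ENNReal.ofReal (-Real.log (lam i - ⟪l i, x⟫)) := by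
        refine lintegral_mono fun x => ?_
        obtain ⟨i, hi⟩ := exists_eq_minSlack l lam x
        simp only [hi]
        exact Finset.single_le_sum
          (f := fun i => ENNReal.ofReal (-Real.log (lam i - ⟪l i, x⟫)))
          (fun _ _ => zero_le) (Finset.mem_univ i)
    _ = ∑ i, ∫⁻ x in s, ENNReal.ofReal (-Real.log (lam i - ⟪l i, x⟫)) :=
        lintegral_finsetSum _ fun i _ => by fun_prop
    _ < ⊤ := ENNReal.sum_lt_top.2 fun i _ =>
        setLIntegral_ofReal_neg_log_affine_lt_top hs (hl i) (lam i)

/-! ### The weighted integral of the Laplacian of a convex function -/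

theorem exists_cutoff_le (hbd : Bornology.IsBounded (Poly l lam)) {ε : ℝ} (hε : 0 ≤ ε) :
    ∃ C, ∀ x, cutoff l lam ε x ≤ C := by
  obtain ⟨R, hR⟩ := hbd.subset_closedBall 0
  set M := |minSlack l lam 0| + (∑ i, ‖l i‖) * |R| with hM
  have hM0 : 0 ≤ M := by positivity
  refine ⟨M ^ 2, fun x => pow_le_pow_left₀ (le_max_right _ _) (max_le ?_ hM0) 2⟩
  by_cases hx : x ∈ Poly l lam
  · have h1 := minSlack_add_le (l := l) (lam := lam) 0 x
    have h2 : ‖x‖ ≤ |R| := (mem_closedBall_zero_iff.1 (hR hx)).trans (le_abs_self R)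
    have h3 : (∑ i, ‖l i‖) * ‖x‖ ≤ (∑ i, ‖l i‖) * |R| := by gcongr
    have h4 := le_abs_self (minSlack l lam 0)
    rw [zero_add] at h1
    linarith
  · rw [← minSlack_pos_iff, not_lt] at hx
    linarith

theorem cutoff_mul_second_difference_nonneg {u : EuclideanSpace ℝ (Fin n) → ℝ}
    (hconv : ConvexOn ℝ (Poly l lam) u) {y : EuclideanSpace ℝ (Fin n)} {ε : ℝ}
    (hε : (∑ i, ‖l i‖) * ‖y‖ ≤ ε) (x : EuclideanSpace ℝ (Fin n)) :
    0 ≤ cutoff l lam ε x * ((Poly l lam).indicator u (x + y) + (Poly l lam).indicator u (x - y)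
      - 2 * (Poly l lam).indicator u x) := by
  rcases le_or_gt (minSlack l lam x) ε with h | h
  · rw [cutoff, max_eq_right (by linarith)]
    simp
  · refine mul_nonneg (cutoff_nonneg ε x) ?_
    have hε0 : 0 ≤ ε := le_trans (by positivity) hε
    have a3 := minSlack_add_le (l := l) (lam := lam) (x + y) (-y)
    have a4 := minSlack_add_le (l := l) (lam := lam) (x - y) y
    rw [add_neg_cancel_right, norm_neg] at a3
    rw [sub_add_cancel] at a4
    have hp : x + y ∈ Poly l lam := minSlack_pos_iff.1 (by linarith)
    have hm : x - y ∈ Poly l lam := minSlack_pos_iff.1 (by linarith)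
    have hx : x ∈ Poly l lam := minSlack_pos_iff.1 (by linarith)
    rw [Set.indicator_of_mem hp, Set.indicator_of_mem hm, Set.indicator_of_mem hx]
    exact symmetric_second_difference_nonneg hconv hp hm

theorem integrable_cutoff_mul (hbd : Bornology.IsBounded (Poly l lam)) {ε : ℝ} (hε : 0 ≤ ε)
    {w : EuclideanSpace ℝ (Fin n) → ℝ} (hw : Integrable w) (y : EuclideanSpace ℝ (Fin n)) :
    Integrable fun x => cutoff l lam ε (x + y) * w x := by
  obtain ⟨C, hC⟩ := exists_cutoff_le hbd hε
  refine hw.bdd_mul (c := C)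
    ((measurable_cutoff ε).comp (measurable_add_const y)).aestronglyMeasurable
    (Filter.Eventually.of_forall fun x => ?_)
  rw [Real.norm_of_nonneg (cutoff_nonneg _ _)]
  exact hC _

theorem integrable_cutoff_mul_second_difference (hbd : Bornology.IsBounded (Poly l lam)) {ε : ℝ}
    (hε : 0 ≤ ε) {w : EuclideanSpace ℝ (Fin n) → ℝ} (hw : Integrable w)
    (y : EuclideanSpace ℝ (Fin n)) :
    Integrable fun x => cutoff l lam ε x * (w (x + y) + w (x - y) - 2 * w x) := by
  simpa using integrable_cutoff_mul hbd hε
    (((hw.comp_add_right y).add (hw.comp_sub_right y)).sub (hw.const_mul 2)) 0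

theorem integral_cutoff_mul_second_difference_le (hbd : Bornology.IsBounded (Poly l lam)) {ε : ℝ}
    (hε : 0 ≤ ε) {w : EuclideanSpace ℝ (Fin n) → ℝ} (hw : Integrable w) (hw0 : ∀ x, 0 ≤ w x)
    (y : EuclideanSpace ℝ (Fin n)) :
    ∫ x, cutoff l lam ε x * (w (x + y) + w (x - y) - 2 * w x)
      ≤ 2 * (∑ i, ‖l i‖) ^ 2 * ‖y‖ ^ 2 * ∫ x, w x := by
  have i0 : Integrable fun x => cutoff l lam ε x * w x := by
    simpa using integrable_cutoff_mul hbd hε hw 0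
  have ip : Integrable fun x => cutoff l lam ε (x + y) * w x := integrable_cutoff_mul hbd hε hw y
  have im : Integrable fun x => cutoff l lam ε (x - y) * w x := by
    simpa [sub_eq_add_neg] using integrable_cutoff_mul hbd hε hw (-y)
  have jp : Integrable fun x => cutoff l lam ε x * w (x + y) := by
    simpa using im.comp_add_right y
  have jm : Integrable fun x => cutoff l lam ε x * w (x - y) := by
    simpa using ip.comp_sub_right y
  have ep : ∫ x, cutoff l lam ε x * w (x + y) = ∫ x, cutoff l lam ε (x - y) * w x := by
    simpa using integral_add_right_eq_self (μ := volume)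
      (fun x => cutoff l lam ε (x - y) * w x) y
  have em : ∫ x, cutoff l lam ε x * w (x - y) = ∫ x, cutoff l lam ε (x + y) * w x := by
    simpa using integral_sub_right_eq_self (μ := volume)
      (fun x => cutoff l lam ε (x + y) * w x) y
  calc ∫ x, cutoff l lam ε x * (w (x + y) + w (x - y) - 2 * w x)
      = ∫ x, (cutoff l lam ε x * w (x + y) + cutoff l lam ε x * w (x - y)
          - 2 * (cutoff l lam ε x * w x)) := by
        congr with x; ring
    _ = ∫ x, (cutoff l lam ε (x - y) * w x + cutoff l lam ε (x + y) * w x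
          - 2 * (cutoff l lam ε x * w x)) := by
        rw [integral_sub (by exact jp.add jm) (i0.const_mul 2), integral_add jp jm, ep, em,
          integral_sub (by exact im.add ip) (i0.const_mul 2), integral_add im ip]
    _ ≤ ∫ x, 2 * (∑ i, ‖l i‖) ^ 2 * ‖y‖ ^ 2 * w x := by
        refine integral_mono ((im.add ip).sub (i0.const_mul 2)) (hw.const_mul _) fun x => ?_
        have := mul_le_mul_of_nonneg_right
          (cutoff_second_difference_le (l := l) (lam := lam) ε x y) (hw0 x)
        simp only
        linarith
    _ = _ := integral_const_mul _ _

/-- The integral over the polytope of the Laplacian of a nonnegative convex function, weighted by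
the square of the smallest slack, is controlled by the integral of the function. -/
theorem lintegral_sq_minSlack_mul_trace_hessianMatrix_le
    (hbd : Bornology.IsBounded (Poly l lam)) {u : EuclideanSpace ℝ (Fin n) → ℝ}
    (hconv : ConvexOn ℝ (Poly l lam) u) (hu : ∀ x ∈ Poly l lam, ContDiffAt ℝ 2 u x)
    (hu0 : ∀ x ∈ Poly l lam, 0 ≤ u x) (hint : IntegrableOn u (Poly l lam)) :
    ∫⁻ x in Poly l lam, ENNReal.ofReal (minSlack l lam x ^ 2 * (hessianMatrix u x).trace)
      ≤ ENNReal.ofReal (n * (2 * (∑ i, ‖l i‖) ^ 2 * ∫ x in Poly l lam, u x)) := by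
  have hP := isOpen_Poly l lam
  set L := ∑ i, ‖l i‖ with hL
  have hL0 : 0 ≤ L := by positivity
  set w := (Poly l lam).indicator u with hw
  have hwi : Integrable w := hint.integrable_indicator hP.measurableSet
  have hw0 : ∀ x, 0 ≤ w x := fun x => Set.indicator_nonneg hu0 x
  set h : ℕ → ℝ := fun k => 1 / ((k : ℝ) + 1) with hh
  have hpos : ∀ k, 0 < h k := fun k => by positivity
  have hlim : Tendsto h atTop (𝓝 0) := tendsto_one_div_add_atTop_nhds_zero_nat
  have hlim' : Tendsto h atTop (𝓝[≠] 0) :=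
    tendsto_nhdsWithin_iff.2 ⟨hlim, Filter.Eventually.of_forall fun k => (hpos k).ne'⟩
  set e : Fin n → EuclideanSpace ℝ (Fin n) := fun i => EuclideanSpace.single i 1 with he
  have hnorm : ∀ k i, ‖h k • e i‖ = h k := fun k i => by
    rw [norm_smul, Real.norm_of_nonneg (hpos k).le]; simp [he]
  set D : ℕ → Fin n → EuclideanSpace ℝ (Fin n) → ℝ := fun k i x =>
    cutoff l lam (L * h k) x * (w (x + h k • e i) + w (x - h k • e i) - 2 * w x) with hD
  have hDi : ∀ k i, Integrable (D k i) := fun k i =>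
    integrable_cutoff_mul_second_difference hbd (mul_nonneg hL0 (hpos k).le) hwi _
  have hD0 : ∀ k i x, 0 ≤ D k i x := fun k i x =>
    cutoff_mul_second_difference_nonneg hconv (by rw [hnorm]) x
  set F : ℕ → EuclideanSpace ℝ (Fin n) → ℝ := fun k x => ∑ i, D k i x / h k ^ 2 with hF
  have hFi : ∀ k, Integrable (F k) := fun k =>
    integrable_finsetSum _ fun i _ => (hDi k i).div_const _
  have hF0 : ∀ k x, 0 ≤ F k x := fun k x =>
    Finset.sum_nonneg fun i _ => div_nonneg (hD0 k i x) (sq_nonneg _)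
  have hbound : ∀ k, ∫⁻ x, ENNReal.ofReal (F k x)
      ≤ ENNReal.ofReal (n * (2 * L ^ 2 * ∫ x in Poly l lam, u x)) := by
    intro k
    rw [← ofReal_integral_eq_lintegral_ofReal (hFi k) (Filter.Eventually.of_forall (hF0 k))]
    refine ENNReal.ofReal_le_ofReal ?_
    rw [hF, integral_finsetSum _ fun i _ => (hDi k i).div_const _]
    refine (Finset.sum_le_card_nsmul _ _ (2 * L ^ 2 * ∫ x in Poly l lam, u x)
      fun i _ => ?_).trans_eq (by simp)
    rw [integral_div, div_le_iff₀ (pow_pos (hpos k) 2)]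
    refine (integral_cutoff_mul_second_difference_le hbd (mul_nonneg hL0 (hpos k).le) hwi hw0
      _).trans_eq ?_
    rw [hnorm, hw, integral_indicator hP.measurableSet]
    ring
  have hconvg : ∀ x ∈ Poly l lam, Tendsto (fun k => ENNReal.ofReal (F k x)) atTop
      (𝓝 (ENNReal.ofReal (minSlack l lam x ^ 2 * (hessianMatrix u x).trace))) := by
    intro x hx
    refine (ENNReal.continuous_ofReal.tendsto _).comp ?_
    have hcut : Tendsto (fun k => cutoff l lam (L * h k) x) atTop (𝓝 (minSlack l lam x ^ 2)) := by
      have hc : Continuous fun t : ℝ => max (minSlack l lam x - L * t) 0 ^ 2 := by fun_prop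
      have := (hc.tendsto 0).comp hlim
      simpa [cutoff, Function.comp_def, max_eq_left (minSlack_pos_iff.2 hx).le] using this
    rw [Matrix.trace, Finset.mul_sum]
    refine tendsto_finsetSum _ fun i _ => ?_
    have hsd := (tendsto_symmetric_second_difference (hu x hx) (e i)).comp hlim'
    refine (hcut.mul hsd).congr' ?_
    have hxp : ∀ᶠ k in atTop, x + h k • e i ∈ Poly l lam := by
      have hc : Continuous fun t : ℝ => x + t • e i := by fun_prop
      exact hlim.eventually (hc.continuousAt.eventually (hP.mem_nhds (by simpa using hx)))
    have hxm : ∀ᶠ k in atTop, x - h k • e i ∈ Poly l lam := by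
      have hc : Continuous fun t : ℝ => x - t • e i := by fun_prop
      exact hlim.eventually (hc.continuousAt.eventually (hP.mem_nhds (by simpa using hx)))
    filter_upwards [hxp, hxm] with k h1 h2
    simp only [hD, hw, Function.comp_apply, Set.indicator_of_mem h1, Set.indicator_of_mem h2,
      Set.indicator_of_mem hx, mul_div_assoc]
  calc ∫⁻ x in Poly l lam, ENNReal.ofReal (minSlack l lam x ^ 2 * (hessianMatrix u x).trace)
      = ∫⁻ x in Poly l lam, liminf (fun k => ENNReal.ofReal (F k x)) atTop :=
        setLIntegral_congr_fun hP.measurableSet fun x hx => (hconvg x hx).liminf_eq.symm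
    _ ≤ liminf (fun k => ∫⁻ x in Poly l lam, ENNReal.ofReal (F k x)) atTop :=
        lintegral_liminf_le' fun k => (hFi k).aemeasurable.ennreal_ofReal.restrict
    _ ≤ ENNReal.ofReal (n * (2 * L ^ 2 * ∫ x in Poly l lam, u x)) :=
        liminf_le_of_le (by isBoundedDefault) fun b hb => by
          obtain ⟨k, hk⟩ := hb.exists
          exact hk.trans ((setLIntegral_le_lintegral _ _).trans (hbound k))

/-- For nonnegative convex functions on a bounded polytope, the integral of the logarithm of the
Hessian determinant is at most an affine function of the integral. -/
theorem exists_integral_log_det_hessianMatrix_le (hl : ∀ i, l i ≠ 0)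
    (hbd : Bornology.IsBounded (Poly l lam)) :
    ∃ A B : ℝ, ∀ u : EuclideanSpace ℝ (Fin n) → ℝ, ConvexOn ℝ (Poly l lam) u →
      (∀ x ∈ Poly l lam, ContDiffAt ℝ 2 u x) → (∀ x ∈ Poly l lam, 0 ≤ u x) →
      IntegrableOn u (Poly l lam) →
      ∫ x in Poly l lam, Real.log (hessianMatrix u x).det ≤ A + B * ∫ x in Poly l lam, u x := by
  have hP := isOpen_Poly l lam
  obtain ⟨M, hM⟩ := exists_cutoff_le hbd le_rfl
  set L := ∑ i, ‖l i‖ with hL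
  set V := ∫⁻ x in Poly l lam, ENNReal.ofReal (-Real.log (minSlack l lam x)) with hV
  have hVtop : V < ⊤ := setLIntegral_ofReal_neg_log_minSlack_lt_top hl hbd
  set Q := ∫⁻ _ in Poly l lam, ENNReal.ofReal M with hQ
  have hQtop : Q < ⊤ := by
    rw [hQ, setLIntegral_const]
    exact ENNReal.mul_lt_top ENNReal.ofReal_lt_top hbd.measure_lt_top
  have hmlog : Measurable fun x => ENNReal.ofReal (-Real.log (minSlack l lam x)) :=
    (measurable_minSlack l lam).log.neg.ennreal_ofReal
  refine ⟨n * (Q.toReal + 2 * V.toReal), n * (n * (2 * L ^ 2)), fun u hconv hu hu0 hint => ?_⟩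
  set I := ∫ x in Poly l lam, u x with hI
  have hI0 : 0 ≤ I := setIntegral_nonneg hP.measurableSet hu0
  set J := n * (2 * L ^ 2 * I) with hJ
  have hJ0 : 0 ≤ J := by positivity
  have hE := lintegral_sq_minSlack_mul_trace_hessianMatrix_le hbd hconv hu hu0 hint
  have hpt : ∀ x ∈ Poly l lam, ENNReal.ofReal (Real.log (hessianMatrix u x).det) ≤
      n * (ENNReal.ofReal M + 2 * ENNReal.ofReal (-Real.log (minSlack l lam x))
        + ENNReal.ofReal (minSlack l lam x ^ 2 * (hessianMatrix u x).trace)) := by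
    intro x hx
    have hH := hessianMatrix_posSemidef hP hconv hx (hu x hx)
    have hr := minSlack_pos_iff.2 hx
    have h1 := log_det_le_of_posSemidef hH
    have h2 := log_one_add_le hr hH.trace_nonneg
    have h3 : minSlack l lam x ^ 2 ≤ M := by
      simpa [cutoff, max_eq_left hr.le] using hM x
    calc ENNReal.ofReal (Real.log (hessianMatrix u x).det)
        ≤ ENNReal.ofReal (n * (M + 2 * (-Real.log (minSlack l lam x))
            + minSlack l lam x ^ 2 * (hessianMatrix u x).trace)) := by
          refine ENNReal.ofReal_le_ofReal (h1.trans ?_)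
          gcongr
          linarith
      _ ≤ _ := by
          rw [ENNReal.ofReal_mul n.cast_nonneg, ENNReal.ofReal_natCast]
          gcongr
          refine ENNReal.ofReal_add_le.trans (add_le_add_left (ENNReal.ofReal_add_le.trans ?_) _)
          rw [ENNReal.ofReal_mul two_pos.le, ENNReal.ofReal_ofNat]
  have hlint : ∫⁻ x in Poly l lam, ENNReal.ofReal (Real.log (hessianMatrix u x).det) ≤
      n * (Q + 2 * V + ENNReal.ofReal J) := by
    refine (setLIntegral_mono' hP.measurableSet hpt).trans ?_
    rw [lintegral_const_mul' _ _ (ENNReal.natCast_ne_top n),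
      lintegral_add_left (by exact measurable_const.add (hmlog.const_mul 2)),
      lintegral_add_left measurable_const, lintegral_const_mul _ hmlog]
    gcongr
  have htop : (n : ℝ≥0∞) * (Q + 2 * V + ENNReal.ofReal J) ≠ ⊤ := by finiteness
  have hreal : (∫⁻ x in Poly l lam, ENNReal.ofReal (Real.log (hessianMatrix u x).det)).toReal
      ≤ n * (Q.toReal + 2 * V.toReal + J) := by
    refine (ENNReal.toReal_mono htop hlint).trans_eq ?_
    rw [ENNReal.toReal_mul, ENNReal.toReal_add (by finiteness) (by finiteness),
      ENNReal.toReal_add (by finiteness) (by finiteness), ENNReal.toReal_mul,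
      ENNReal.toReal_ofReal hJ0]
    simp
  have hle : ∫ x in Poly l lam, Real.log (hessianMatrix u x).det ≤
      (∫⁻ x in Poly l lam, ENNReal.ofReal (Real.log (hessianMatrix u x).det)).toReal := by
    by_cases hi : IntegrableOn (fun x => Real.log (hessianMatrix u x).det) (Poly l lam)
    · rw [integral_eq_lintegral_pos_part_sub_lintegral_neg_part hi]
      exact sub_le_self _ ENNReal.toReal_nonneg
    · rw [integral_undef hi]
      exact ENNReal.toReal_nonneg
  refine hle.trans (hreal.trans_eq ?_)
  rw [hJ]
  ring

end Slack

/-! ### Regularity of the class `𝒞` -/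

section ClassC

variable {n : ℕ} {ι : Type*} [Fintype ι] {l : ι → EuclideanSpace ℝ (Fin n)} {lam : ι → ℝ}
  {u : EuclideanSpace ℝ (Fin n) → ℝ}

theorem continuous_guillemin (l : ι → EuclideanSpace ℝ (Fin n)) (lam : ι → ℝ) :
    Continuous (guillemin l lam) :=
  continuous_finsetSum _ fun i _ => Real.continuous_mul_log.comp (by fun_prop)

theorem contDiffAt_guillemin {x : EuclideanSpace ℝ (Fin n)} (hx : x ∈ Poly l lam) :
    ContDiffAt ℝ 2 (guillemin l lam) x := by
  refine ContDiffAt.sum fun i _ => ?_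
  have h : ContDiffAt ℝ 2 (fun x => lam i - ⟪l i, x⟫) x :=
    contDiffAt_const.sub (contDiffAt_const.inner ℝ contDiffAt_id)
  exact h.mul (h.log (sub_ne_zero.2 (hx i).ne'))

theorem MemC.continuousOn_closure (h : MemC l lam u) :
    ContinuousOn u (closure (Poly l lam)) := by
  obtain ⟨-, v, hv, huv⟩ := h
  exact ((continuous_guillemin l lam).continuousOn.add hv.continuousOn).congr huv

theorem MemC.contDiffAt (h : MemC l lam u) {x : EuclideanSpace ℝ (Fin n)}
    (hx : x ∈ Poly l lam) : ContDiffAt ℝ 2 u x := by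
  obtain ⟨-, v, hv, huv⟩ := h
  have hnhds : closure (Poly l lam) ∈ 𝓝 x :=
    mem_of_superset ((isOpen_Poly l lam).mem_nhds hx) subset_closure
  have hv2 : ContDiffAt ℝ 2 v x :=
    (hv.contDiffAt hnhds).of_le (WithTop.coe_le_coe.2 (le_top : (2 : ℕ∞) ≤ ⊤))
  exact ((contDiffAt_guillemin hx).add hv2).congr_of_eventuallyEq
    (Filter.eventually_of_mem hnhds huv)

theorem integrableOn_of_continuousOn_closure {s : Set (EuclideanSpace ℝ (Fin n))}
    (hs : Bornology.IsBounded s) {g : EuclideanSpace ℝ (Fin n) → ℝ}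
    (hg : ContinuousOn g (closure s)) : IntegrableOn g s :=
  (hg.integrableOn_compact hs.isCompact_closure).mono_set subset_closure

end ClassC

theorem nonempty_of_isBounded_Poly {n : ℕ} (hn : 1 ≤ n) {ι : Type*} [Fintype ι]
    {l : ι → EuclideanSpace ℝ (Fin n)} {lam : ι → ℝ}
    (hbd : Bornology.IsBounded (Poly l lam)) : Nonempty ι := by
  by_contra hne
  rw [not_nonempty_iff] at hne
  have huniv : Poly l lam = Set.univ := Set.eq_univ_of_forall fun x i => hne.elim i
  have : Nonempty (Fin n) := ⟨⟨0, hn⟩⟩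
  rw [huniv] at hbd
  exact NormedSpace.unbounded_univ ℝ _ hbd

/-- (4.3)/(4.4): if `ℱ` is proper on `𝒞̃`, then almost-minimizers of
`ℱ` in `𝒞̃` have uniformly bounded boundary integrals `∫_{∂P} u dσ`. -/
theorem boundary_integral_bound_of_almost_minimizer
    (n d : ℕ) (hn : 1 ≤ n) (l : Fin d → EuclideanSpace ℝ (Fin n)) (lam : Fin d → ℝ)
    (hl : ∀ i, l i ≠ 0) (hlam : ∀ i, 0 < lam i)
    (hbd : Bornology.IsBounded (Poly l lam)) (hDel : IsDelzant l lam)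
    (f : EuclideanSpace ℝ (Fin n) → ℝ) (hf : IsAffineFn f)
    (p : ℝ → ℝ) (hp : Continuous p) (hptop : Tendsto p atTop atTop)
    (hproper : ∀ v : EuclideanSpace ℝ (Fin n) → ℝ, MemCt l lam v →
      p (∫ x in Poly l lam, v x) ≤ FcalSmooth l lam f v) :
    ∃ K₀ : ℝ, 0 < K₀ ∧ ∀ u : EuclideanSpace ℝ (Fin n) → ℝ, MemCt l lam u →
      FcalSmooth l lam f u ≤
        sInf {y : ℝ | ∃ v, MemCt l lam v ∧ y = FcalSmooth l lam f v} + 1 →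
      ∫ z, u z ∂(sigmaW l lam) < K₀ := by
  have hP := isOpen_Poly l lam
  have := nonempty_of_isBounded_Poly hn hbd
  obtain ⟨A, B, hAB⟩ := exists_integral_log_det_hessianMatrix_le hl hbd
  set C := sInf {y : ℝ | ∃ v, MemCt l lam v ∧ y = FcalSmooth l lam f v} + 1
  obtain ⟨g, c, hfg⟩ := hf
  have hfc : Continuous f := by
    rw [show f = fun x => ⟪g, x⟫ + c from funext hfg]
    fun_prop
  obtain ⟨M, hM⟩ := hbd.isCompact_closure.exists_bound_of_continuousOn hfc.continuousOn
  obtain ⟨T, hT⟩ := Filter.eventually_atTop.1 (hptop.eventually_gt_atTop C)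
  refine ⟨|C + A| + |B + M| * |T| + 1, by positivity, fun u hu hFu => ?_⟩
  have hcont := hu.1.continuousOn_closure
  have hint : IntegrableOn u (Poly l lam) := integrableOn_of_continuousOn_closure hbd hcont
  have hI0 : 0 ≤ ∫ x in Poly l lam, u x := setIntegral_nonneg hP.measurableSet hu.2.2
  have hIT : ∫ x in Poly l lam, u x ≤ T := by
    by_contra! hlt
    exact absurd ((hproper u hu).trans hFu) (not_le.2 (hT _ hlt.le))
  have hlog := hAB u hu.1.1 (fun x hx => hu.1.contDiffAt hx) hu.2.2 hint
  have hfu : ∫ x in Poly l lam, f x * u x ≤ M * ∫ x in Poly l lam, u x := by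
    rw [← integral_const_mul]
    refine setIntegral_mono_on
      (integrableOn_of_continuousOn_closure hbd (hfc.continuousOn.mul hcont))
      (hint.const_mul M) hP.measurableSet fun x hx => ?_
    exact mul_le_mul_of_nonneg_right ((le_abs_self _).trans (hM x (subset_closure hx)))
      (hu.2.2 x hx)
  have hBM : (B + M) * ∫ x in Poly l lam, u x ≤ |B + M| * |T| :=
    mul_le_mul (le_abs_self _) (hIT.trans (le_abs_self T)) hI0 (abs_nonneg _)
  have hCA := le_abs_self (C + A)
  rw [FcalSmooth] at hFu
  linarith

end ToricExtremal
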